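/- Assume that for every Y ∈ ℳ_p the matrices A_1 Y, …, A_m Y are linearly independent. Let Y ∈ ℳ_p be a second-order critical point (S(Y)Y = 0 and ⟨Ẏ, S(Y)Ẏ⟩ ≥ 0 for all Ẏ with ⟨A_i Y, Ẏ⟩ = 0 for all i). If rank(Y) < p, or if rank(Y) = p and the dimension of the subspace {A ∈ Sym(p,ℝ) : 𝒜(Y A Yᵀ) = 0} is strictly less than p(p+1)/2 − m + p, then Y is globally optimal for the factorized problem (⟨C Y, Y⟩ ≤ ⟨C Y', Y'⟩ for all Y' ∈ ℳ_p) and X = YYᵀ is globally optimal for the SDP (⟨C, X⟩ ≤ ⟨C, X'⟩ for all X' ∈ 𝒞). -/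

import Mathlib

open Matrix MeasureTheory

noncomputable section

/-- Frobenius inner product ⟨A,B⟩ = trace(AᵀB). -/
def ip {n p : ℕ} (A B : Matrix (Fin n) (Fin p) ℝ) : ℝ := Matrix.trace (Aᵀ * B)

/-- The constraint map 𝒜(X)ᵢ = trace(Aᵢ X). -/
def calA {n m : ℕ} (A : Fin m → Matrix (Fin n) (Fin n) ℝ) (X : Matrix (Fin n) (Fin n) ℝ) :
    Fin m → ℝ := fun i => Matrix.trace (A i * X)

/-- The adjoint 𝒜*(ν) = ∑ νᵢ Aᵢ. -/
def adjA {n m : ℕ} (A : Fin m → Matrix (Fin n) (Fin n) ℝ) (ν : Fin m → ℝ) :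
    Matrix (Fin n) (Fin n) ℝ := ∑ i, ν i • A i

/-- ℳ_p = {Y ∈ ℝ^{n×p} : 𝒜(YYᵀ) = b}. -/
def MM {n m : ℕ} (A : Fin m → Matrix (Fin n) (Fin n) ℝ) (b : Fin m → ℝ) (p : ℕ) :
    Set (Matrix (Fin n) (Fin p) ℝ) := {Y | calA A (Y * Yᵀ) = b}

/-- 𝒞 = {X ∈ Sym(n,ℝ) : 𝒜(X) = b, X ⪰ 0}. -/
def CC {n m : ℕ} (A : Fin m → Matrix (Fin n) (Fin n) ℝ) (b : Fin m → ℝ) :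
    Set (Matrix (Fin n) (Fin n) ℝ) := {X | X.IsSymm ∧ calA A X = b ∧ X.PosSemidef}

/-- Gram matrix G(Y)ᵢⱼ = ⟨AᵢY, AⱼY⟩. -/
def gram {n m p : ℕ} (A : Fin m → Matrix (Fin n) (Fin n) ℝ) (Y : Matrix (Fin n) (Fin p) ℝ) :
    Matrix (Fin m) (Fin m) ℝ := Matrix.of fun i j => ip (A i * Y) (A j * Y)

/-- S(Y) = C − 𝒜*(G(Y)⁻¹ 𝒜(C Y Yᵀ)). -/
def Smat {n m p : ℕ} (A : Fin m → Matrix (Fin n) (Fin n) ℝ) (C : Matrix (Fin n) (Fin n) ℝ)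
    (Y : Matrix (Fin n) (Fin p) ℝ) : Matrix (Fin n) (Fin n) ℝ :=
  C - adjA A ((gram A Y)⁻¹ *ᵥ calA A (C * (Y * Yᵀ)))

/-- Frobenius norm. -/
def frob {a c : ℕ} (M : Matrix (Fin a) (Fin c) ℝ) : ℝ := Real.sqrt (∑ i, ∑ j, (M i j) ^ 2)


/-- The subspace {A ∈ Sym(p,ℝ) : 𝒜(Y A Yᵀ) = 0}, whose dimension is the dimension of
the face of 𝒞 containing X = YYᵀ in its relative interior. -/
def faceSpace {n m p : ℕ} (A : Fin m → Matrix (Fin n) (Fin n) ℝ)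
    (Y : Matrix (Fin n) (Fin p) ℝ) : Submodule ℝ (Matrix (Fin p) (Fin p) ℝ) where
  carrier := {B | B.IsSymm ∧ ∀ i, Matrix.trace (A i * (Y * B * Yᵀ)) = 0}
  add_mem' := by
    rintro B C ⟨hB1, hB2⟩ ⟨hC1, hC2⟩
    refine ⟨?_, fun i => ?_⟩
    · simp [Matrix.IsSymm, Matrix.transpose_add, hB1.eq, hC1.eq]
    · simp [Matrix.mul_add, Matrix.add_mul, hB2 i, hC2 i]
  zero_mem' := by
    refine ⟨?_, fun i => ?_⟩ <;> simp [Matrix.IsSymm]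
  smul_mem' := by
    rintro c B ⟨hB1, hB2⟩
    refine ⟨?_, fun i => ?_⟩
    · simp [Matrix.IsSymm, Matrix.transpose_smul, hB1.eq]
    · simp [Matrix.mul_smul, Matrix.smul_mul, hB2 i]

open Module

section Helpers

variable {n m p : ℕ}

lemma trace_adjA_mul (A : Fin m → Matrix (Fin n) (Fin n) ℝ) (ν : Fin m → ℝ)
    (X : Matrix (Fin n) (Fin n) ℝ) : Matrix.trace (adjA A ν * X) = ν ⬝ᵥ calA A X := by
  simp [adjA, calA, Matrix.sum_mul, Matrix.trace_sum, dotProduct]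

lemma adjA_isSymm {A : Fin m → Matrix (Fin n) (Fin n) ℝ} (hA : ∀ i, (A i).IsSymm)
    (ν : Fin m → ℝ) : (adjA A ν).IsSymm := by
  simp [Matrix.IsSymm, adjA, Matrix.transpose_sum, Matrix.transpose_smul, fun i => (hA i).eq]

open scoped MatrixOrder Matrix.Norms.L2Operator in
/-- The Frobenius pairing of a matrix with nonnegative quadratic form and a positive semidefinite
matrix is nonnegative. -/
lemma trace_mul_nonneg_of_posSemidef {S X : Matrix (Fin n) (Fin n) ℝ}
    (hS : ∀ u, 0 ≤ u ⬝ᵥ (S *ᵥ u)) (hX : X.PosSemidef) : 0 ≤ Matrix.trace (S * X) := by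
  obtain ⟨D, rfl⟩ := CStarAlgebra.nonneg_iff_eq_star_mul_self.mp hX.nonneg
  rw [Matrix.star_eq_conjTranspose, Matrix.conjTranspose_eq_transpose_of_trivial,
    ← Matrix.mul_assoc, Matrix.trace_mul_comm]
  refine Finset.sum_nonneg fun i _ => ?_
  exact hS (D i)

/-- A dual certificate `C - 𝒜*(ν)` which has nonnegative quadratic form and annihilates `Y` proves
optimality of `Y * Yᵀ` for the semidefinite program. -/
lemma trace_mul_le_of_dual_certificate {A : Fin m → Matrix (Fin n) (Fin n) ℝ}
    {C : Matrix (Fin n) (Fin n) ℝ} {b ν : Fin m → ℝ} {Y : Matrix (Fin n) (Fin p) ℝ}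
    (hY : Y ∈ MM A b p) (hcrit : (C - adjA A ν) * Y = 0)
    (hS : ∀ u, 0 ≤ u ⬝ᵥ ((C - adjA A ν) *ᵥ u)) {X : Matrix (Fin n) (Fin n) ℝ}
    (hX : X ∈ CC A b) : Matrix.trace (C * (Y * Yᵀ)) ≤ Matrix.trace (C * X) := by
  obtain ⟨-, hXb, hXpsd⟩ := hX
  have hYb : calA A (Y * Yᵀ) = b := hY
  have h1 := trace_mul_nonneg_of_posSemidef hS hXpsd
  have h2 : Matrix.trace ((C - adjA A ν) * (Y * Yᵀ)) = 0 := by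
    rw [← Matrix.mul_assoc, hcrit, Matrix.zero_mul, Matrix.trace_zero]
  rw [Matrix.sub_mul, Matrix.trace_sub, trace_adjA_mul] at h1 h2
  rw [hXb] at h1
  rw [hYb] at h2
  linarith

lemma mul_transpose_mem_CC {A : Fin m → Matrix (Fin n) (Fin n) ℝ} {b : Fin m → ℝ}
    {Y : Matrix (Fin n) (Fin p) ℝ} (hY : Y ∈ MM A b p) : Y * Yᵀ ∈ CC A b := by
  refine ⟨by simp [Matrix.IsSymm, Matrix.transpose_mul], hY, ?_⟩
  simpa using Matrix.posSemidef_self_mul_conjTranspose Y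

lemma ip_mul_self (C : Matrix (Fin n) (Fin n) ℝ) (Y : Matrix (Fin n) (Fin p) ℝ) :
    ip (C * Y) Y = Matrix.trace (Cᵀ * (Y * Yᵀ)) := by
  rw [ip, Matrix.transpose_mul, Matrix.mul_assoc, Matrix.trace_mul_comm, Matrix.mul_assoc]

/-- If `S` is symmetric and `S * Y = 0`, the quadratic form of `S` at `Y * B + u zᵀ` only sees the
rank-one term. -/
lemma ip_mul_add_vecMulVec {S : Matrix (Fin n) (Fin n) ℝ} (hS : S.IsSymm)
    {Y : Matrix (Fin n) (Fin p) ℝ} (hSY : S * Y = 0) (B : Matrix (Fin p) (Fin p) ℝ)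
    (u : Fin n → ℝ) (z : Fin p → ℝ) :
    ip (Y * B + vecMulVec u z) (S * (Y * B + vecMulVec u z)) =
      (z ⬝ᵥ z) * (u ⬝ᵥ (S *ᵥ u)) := by
  have hYS : Yᵀ * S = 0 := by
    rw [← hS.eq, ← Matrix.transpose_mul, hSY, Matrix.transpose_zero]
  rw [ip, Matrix.mul_add, ← Matrix.mul_assoc S, hSY, Matrix.zero_mul, zero_add,
    Matrix.transpose_add, Matrix.add_mul, Matrix.transpose_mul, Matrix.mul_assoc Bᵀ,
    ← Matrix.mul_assoc Yᵀ, hYS, Matrix.zero_mul, Matrix.mul_zero, zero_add,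
    Matrix.transpose_vecMulVec, Matrix.mul_vecMulVec, Matrix.vecMulVec_mul_vecMulVec,
    Matrix.trace_vecMulVec]
  simp [mul_comm]

lemma exists_mulVec_eq_zero_of_rank_lt {Y : Matrix (Fin n) (Fin p) ℝ} (h : Y.rank < p) :
    ∃ z, z ≠ 0 ∧ Y *ᵥ z = 0 := by
  by_contra! hz
  have hinj : Function.Injective Y.mulVecLin :=
    (injective_iff_map_eq_zero _).2 fun z hYz => by_contra fun h0 => hz z h0 hYz
  have := LinearMap.finrank_range_of_inj hinj
  rw [finrank_fin_fun] at this
  exact h.ne this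

/-- The symmetric matrix with prescribed entries on unordered pairs of indices. -/
def symMatrix (p : ℕ) : (Sym2 (Fin p) → ℝ) →ₗ[ℝ] Matrix (Fin p) (Fin p) ℝ where
  toFun f := Matrix.of fun i j => f s(i, j)
  map_add' _ _ := rfl
  map_smul' _ _ := rfl

lemma symMatrix_isSymm (f : Sym2 (Fin p) → ℝ) : (symMatrix p f).IsSymm := by
  ext i j
  exact congrArg f Sym2.eq_swap

lemma symMatrix_injective (p : ℕ) : Function.Injective (symMatrix p) := by
  intro f g h
  ext s
  induction s with
  | _ i j => exact congrFun (congrFun h i) j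

/-- The linear map `(B, z) ↦ Y * B + u zᵀ`, with `B` ranging over symmetric matrices. -/
def mulSymAddVecMulVec (Y : Matrix (Fin n) (Fin p) ℝ) (u : Fin n → ℝ) :
    ((Sym2 (Fin p) → ℝ) × (Fin p → ℝ)) →ₗ[ℝ] Matrix (Fin n) (Fin p) ℝ where
  toFun x := Y * symMatrix p x.1 + vecMulVec u x.2
  map_add' x y := by
    simp only [Prod.fst_add, Prod.snd_add, map_add, Matrix.mul_add, Matrix.vecMulVec_add]
    abel
  map_smul' c x := by
    simp [Matrix.vecMulVec_smul]

/-- The linear map `V ↦ (⟨Aᵢ Y, V⟩)ᵢ`, whose kernel is the tangent space at `Y`. -/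
def tangentConstraint (A : Fin m → Matrix (Fin n) (Fin n) ℝ) (Y : Matrix (Fin n) (Fin p) ℝ) :
    Matrix (Fin n) (Fin p) ℝ →ₗ[ℝ] (Fin m → ℝ) where
  toFun V i := ip (A i * Y) V
  map_add' V W := by
    ext i
    simp [ip, Matrix.mul_add]
  map_smul' c V := by
    ext i
    simp [ip]

lemma ip_mul_mul_eq_trace {M : Matrix (Fin n) (Fin n) ℝ} (hM : M.IsSymm)
    (Y : Matrix (Fin n) (Fin p) ℝ) (B : Matrix (Fin p) (Fin p) ℝ) :
    ip (M * Y) (Y * B) = Matrix.trace (M * (Y * B * Yᵀ)) := by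
  rw [ip, Matrix.transpose_mul, hM.eq, Matrix.mul_assoc, Matrix.trace_mul_comm, Matrix.mul_assoc]

/-- A direction of negative curvature of the certificate forces the face to be large. -/
lemma le_finrank_faceSpace {A : Fin m → Matrix (Fin n) (Fin n) ℝ} (hA : ∀ i, (A i).IsSymm)
    {S : Matrix (Fin n) (Fin n) ℝ} (hS : S.IsSymm) {Y : Matrix (Fin n) (Fin p) ℝ}
    (hSY : S * Y = 0)
    (hsoc : ∀ V : Matrix (Fin n) (Fin p) ℝ, (∀ i, ip (A i * Y) V = 0) → 0 ≤ ip V (S * V))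
    {u : Fin n → ℝ} (hu : u ⬝ᵥ (S *ᵥ u) < 0) :
    p * (p + 1) + 2 * p ≤ 2 * finrank ℝ (faceSpace A Y) + 2 * m := by
  let Φ := tangentConstraint A Y ∘ₗ mulSymAddVecMulVec Y u
  have hΦ (x) (hx : x ∈ LinearMap.ker Φ) (i : Fin m) :
      ip (A i * Y) (Y * symMatrix p x.1 + vecMulVec u x.2) = 0 := congrFun hx i
  have hz (x) (hx : x ∈ LinearMap.ker Φ) : x.2 = 0 := by
    have h := hsoc _ (hΦ x hx)
    rw [ip_mul_add_vecMulVec hS hSY] at h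
    have h0 : 0 ≤ x.2 ⬝ᵥ x.2 := Finset.sum_nonneg fun i _ => mul_self_nonneg _
    exact dotProduct_self_eq_zero.1 (le_antisymm (by nlinarith) h0)
  let L := (symMatrix p ∘ₗ LinearMap.fst ℝ _ (Fin p → ℝ)) ∘ₗ (LinearMap.ker Φ).subtype
  have hL (x : LinearMap.ker Φ) : L x ∈ faceSpace A Y := by
    refine ⟨symMatrix_isSymm _, fun i => ?_⟩
    have h := hΦ x x.2 i
    have hu0 : vecMulVec u (0 : Fin p → ℝ) = 0 := by
      ext
      simp [vecMulVec_apply]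
    rw [hz x x.2, hu0, add_zero, ip_mul_mul_eq_trace (hA i)] at h
    exact h
  have hinj : Function.Injective (L.codRestrict (faceSpace A Y) hL) := by
    intro x y hxy
    refine Subtype.ext (Prod.ext (symMatrix_injective p (congrArg Subtype.val hxy)) ?_)
    rw [hz x x.2, hz y y.2]
  have hker := LinearMap.finrank_le_finrank_of_injective hinj
  have hrange : finrank ℝ (LinearMap.range Φ) ≤ m := by
    simpa using Submodule.finrank_le (LinearMap.range Φ)
  have hsum := Φ.finrank_range_add_finrank_ker
  rw [finrank_prod, finrank_fin_fun, finrank_fintype_fun_eq_card, Sym2.card, Fintype.card_fin]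
    at hsum
  have hchoose : (p + 1).choose 2 * 2 = (p + 1) * p := by
    rw [Nat.choose_two_right, Nat.add_sub_cancel]
    exact Nat.div_mul_cancel (by simpa [mul_comm] using (Nat.even_mul_succ_self p).two_dvd)
  linarith

lemma dotProduct_mulVec_nonneg_of_rank_lt {A : Fin m → Matrix (Fin n) (Fin n) ℝ}
    (hA : ∀ i, (A i).IsSymm) {S : Matrix (Fin n) (Fin n) ℝ} (hS : S.IsSymm)
    {Y : Matrix (Fin n) (Fin p) ℝ} (hSY : S * Y = 0)
    (hsoc : ∀ V : Matrix (Fin n) (Fin p) ℝ, (∀ i, ip (A i * Y) V = 0) → 0 ≤ ip V (S * V))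
    (hrank : Y.rank < p) (u : Fin n → ℝ) : 0 ≤ u ⬝ᵥ (S *ᵥ u) := by
  obtain ⟨z, hz, hYz⟩ := exists_mulVec_eq_zero_of_rank_lt hrank
  have h := hsoc (Y * (0 : Matrix (Fin p) (Fin p) ℝ) + vecMulVec u z) fun i => by
    rw [Matrix.mul_zero, zero_add, ip, Matrix.transpose_mul, (hA i).eq, Matrix.mul_vecMulVec,
      Matrix.trace_vecMulVec, ← Matrix.mulVec_mulVec, dotProduct_comm, Matrix.dotProduct_mulVec,
      Matrix.vecMul_transpose, hYz, zero_dotProduct]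
  rw [ip_mul_add_vecMulVec hS hSY] at h
  have h0 : 0 ≤ z ⬝ᵥ z := Finset.sum_nonneg fun i _ => mul_self_nonneg _
  exact nonneg_of_mul_nonneg_right h
    (lt_of_le_of_ne h0 fun h => hz (dotProduct_self_eq_zero.1 h.symm))

end Helpers

/-- Theorem 1.5 of the paper: a second-order critical point Y with
rank(Y) < p, or with rank(Y) = p and dim{A ∈ Sym(p) : 𝒜(YAYᵀ) = 0} < p(p+1)/2 − m + p
(equivalently 2·dim + 2m < p(p+1) + 2p), is globally optimal for the factorized problem,
and X = YYᵀ is globally optimal for the SDP. -/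
theorem stmt12 (n m p : ℕ) (hn : 1 ≤ n) (hm : 1 ≤ m) (hp : 1 ≤ p)
    (A : Fin m → Matrix (Fin n) (Fin n) ℝ) (hA : ∀ i, (A i).IsSymm)
    (C : Matrix (Fin n) (Fin n) ℝ) (hC : C.IsSymm) (b : Fin m → ℝ)
    (hli : ∀ Y ∈ MM A b p, LinearIndependent ℝ (fun i => A i * Y))
    (Y : Matrix (Fin n) (Fin p) ℝ) (hY : Y ∈ MM A b p)
    (hcrit : Smat A C Y * Y = 0)
    (hsoc : ∀ V : Matrix (Fin n) (Fin p) ℝ, (∀ i, ip (A i * Y) V = 0) →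
      0 ≤ ip V (Smat A C Y * V))
    (hcase : Y.rank < p ∨
      (Y.rank = p ∧
        2 * Module.finrank ℝ (faceSpace A Y) + 2 * m < p * (p + 1) + 2 * p)) :
    (∀ Y' ∈ MM A b p, ip (C * Y) Y ≤ ip (C * Y') Y') ∧
    (∀ X' ∈ CC A b, Matrix.trace (Cᵀ * (Y * Yᵀ)) ≤ Matrix.trace (Cᵀ * X')) := by
  have hS : (Smat A C Y).IsSymm := hC.sub (adjA_isSymm hA _)
  have hpsd (u : Fin n → ℝ) : 0 ≤ u ⬝ᵥ (Smat A C Y *ᵥ u) := by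
    rcases hcase with hrank | ⟨-, hdim⟩
    · exact dotProduct_mulVec_nonneg_of_rank_lt hA hS hcrit hsoc hrank u
    · by_contra! hu
      exact absurd (le_finrank_faceSpace hA hS hcrit hsoc hu) hdim.not_ge
  have hopt : ∀ X' ∈ CC A b, Matrix.trace (Cᵀ * (Y * Yᵀ)) ≤ Matrix.trace (Cᵀ * X') := by
    intro X' hX'
    rw [hC.eq]
    exact trace_mul_le_of_dual_certificate hY hcrit hpsd hX'
  refine ⟨fun Y' hY' => ?_, hopt⟩
  rw [ip_mul_self, ip_mul_self]
  exact hopt _ (mul_transpose_mem_CC hY')
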